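/- arXiv:1903.11057 — 3 statements merged into one kernel-verified Lean document; each statement's English description precedes it below -/
import Mathlib

section
/- For all integers r, s, n, m: u(r−s)·w(n+m) = u(n−s)·w(m+r) − q^(r−s)·u(n−r)·w(m+s). -/
/-- A two-sided sequence satisfying a second-order linear recurrence with `q ≠ 0` vanishes
as soon as two consecutive terms do. -/
theorem eq_zero_of_recurrence {K : Type*} [Field K] {p q : K} (hq : q ≠ 0) {f : ℤ → K}
    (hf : ∀ n : ℤ, f n = p * f (n - 1) - q * f (n - 2)) (h0 : f 0 = 0) (h1 : f 1 = 0) (n : ℤ) :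
    f n = 0 := by
  suffices h : f n = 0 ∧ f (n + 1) = 0 from h.1
  induction n using Int.induction_on with
  | zero => simpa using ⟨h0, h1⟩
  | succ i ih =>
    refine ⟨ih.2, ?_⟩
    have h := hf (i + 1 + 1)
    rw [show (i : ℤ) + 1 + 1 - 1 = i + 1 by ring, show (i : ℤ) + 1 + 1 - 2 = i by ring,
      ih.1, ih.2] at h
    simpa using h
  | pred i ih =>
    rw [sub_add_cancel]
    refine ⟨?_, ih.1⟩
    have h := hf (-i + 1)
    rw [show -(i : ℤ) + 1 - 1 = -i by ring, show -(i : ℤ) + 1 - 2 = -i - 1 by ring,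
      ih.1, ih.2] at h
    simpa [hq] using h

/-- The Casoratian of a Lucas sequence and a shifted Horadam sequence is geometric. -/
theorem lucas_mul_horadam_sub {K : Type*} [Field K] {p q : K} (hq : q ≠ 0) {w u : ℤ → K}
    (hw : ∀ n : ℤ, w n = p * w (n - 1) - q * w (n - 2)) (hu0 : u 0 = 0) (hu1 : u 1 = 1)
    (hu : ∀ n : ℤ, u n = p * u (n - 1) - q * u (n - 2)) (m k : ℤ) :
    u (k + 1) * w (m + k) - u k * w (m + k + 1) = q ^ k * w m := by
  have step (j : ℤ) : u (j + 1 + 1) * w (m + (j + 1)) - u (j + 1) * w (m + (j + 1) + 1) =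
      q * (u (j + 1) * w (m + j) - u j * w (m + j + 1)) := by
    have h₁ := hu (j + 1 + 1)
    have h₂ := hw (m + j + 1 + 1)
    rw [show j + 1 + 1 - 1 = j + 1 by ring, show j + 1 + 1 - 2 = j by ring] at h₁
    rw [show m + j + 1 + 1 - 1 = m + j + 1 by ring,
      show m + j + 1 + 1 - 2 = m + j by ring] at h₂
    rw [← add_assoc m j 1, h₁, h₂]
    ring
  induction k using Int.induction_on with
  | zero => simp [hu0, hu1]
  | succ i ih => rw [step, ih, zpow_add_one₀ hq]; ring
  | pred i ih =>
    have h := step (-i - 1)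
    rw [sub_add_cancel, ih] at h
    apply mul_left_cancel₀ hq
    rw [sub_add_cancel, ← h, zpow_sub_one₀ hq]
    field_simp

theorem stmt_1 (p q a b : ℂ) (hq : q ≠ 0) (w u : ℤ → ℂ)
    (hw0 : w 0 = a) (hw1 : w 1 = b)
    (hw : ∀ n : ℤ, w n = p * w (n - 1) - q * w (n - 2))
    (hu0 : u 0 = 0) (hu1 : u 1 = 1)
    (hu : ∀ n : ℤ, u n = p * u (n - 1) - q * u (n - 2))
    (r s n m : ℤ) :
    u (r - s) * w (n + m) = u (n - s) * w (m + r) - q ^ (r - s) * u (n - r) * w (m + s) := by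
  have key := eq_zero_of_recurrence (p := p) hq (f := fun d : ℤ => u (r - s) * w (m + r + d) -
    (u (r - s + d) * w (m + r) - q ^ (r - s) * u d * w (m + s))) ?_ ?_ ?_ (n - r)
  · simp only [show m + r + (n - r) = n + m by ring, show r - s + (n - r) = n - s by ring] at key
    exact sub_eq_zero.mp key
  · intro d
    simp only [← add_sub_assoc]
    rw [hw (m + r + d), hu (r - s + d), hu d]
    ring
  · simp [hu0]
  · have h := lucas_mul_horadam_sub hq hw hu0 hu1 hu (m + s) (r - s)
    rw [show m + s + (r - s) = m + r by ring] at h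
    simp only [hu1]
    linear_combination -h
end

section
/- For all integers n and m: u(m)·w(n) = u(n)·w(m) − q^m·a·u(n−m). -/
/-- A two-sided sequence satisfying a second-order linear recurrence with invertible last
coefficient vanishes identically once two consecutive terms vanish. -/
theorem eq_zero_of_linear_recurrence {K : Type*} [Field K] {p q : K} (hq : q ≠ 0) {f : ℤ → K}
    (h0 : f 0 = 0) (h1 : f 1 = 0)
    (hf : ∀ n : ℤ, f n = p * f (n - 1) - q * f (n - 2)) (n : ℤ) : f n = 0 := by
  have key : ∀ k : ℤ, f k = 0 ∧ f (k + 1) = 0 := by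
    intro k
    induction k using Int.induction_on with
    | zero => exact ⟨h0, by simpa using h1⟩
    | succ i ih =>
      refine ⟨ih.2, ?_⟩
      rw [hf, show (i : ℤ) + 1 + 1 - 1 = i + 1 by ring, show (i : ℤ) + 1 + 1 - 2 = i by ring,
        ih.1, ih.2]
      ring
    | pred i ih =>
      have h := hf (-(i : ℤ) + 1)
      rw [show -(i : ℤ) + 1 - 1 = -i by ring, show -(i : ℤ) + 1 - 2 = -i - 1 by ring,
        ih.1, ih.2] at h
      refine ⟨?_, by simpa using ih.1⟩
      simpa [hq] using h
  exact (key n).1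

theorem stmt_5 (p q a b : ℂ) (hq : q ≠ 0) (w u : ℤ → ℂ)
    (hw0 : w 0 = a) (hw1 : w 1 = b)
    (hw : ∀ n : ℤ, w n = p * w (n - 1) - q * w (n - 2))
    (hu0 : u 0 = 0) (hu1 : u 1 = 1)
    (hu : ∀ n : ℤ, u n = p * u (n - 1) - q * u (n - 2))
    (n m : ℤ) :
    u m * w n = u n * w m - q ^ m * a * u (n - m) := by
  have hneg : q * u (-1) = -1 := by
    have h := hu 1
    norm_num [hu0, hu1] at h
    linear_combination h
  have hbase : w n - u n * b + q * a * u (n - 1) = 0 := by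
    refine eq_zero_of_linear_recurrence (p := p) hq
      (f := fun k => w k - u k * b + q * a * u (k - 1)) ?_ ?_ ?_ n
    · simp only [hw0, hu0, zero_sub]
      linear_combination a * hneg
    · simp [hw1, hu0, hu1]
    · intro k
      have h := hu (k - 1)
      rw [show k - 1 - 2 = k - 2 - 1 by ring] at h
      linear_combination hw k - b * hu k + q * a * h
  have hmain : u m * w n - u n * w m + q ^ m * a * u (n - m) = 0 := by
    refine eq_zero_of_linear_recurrence (p := p) hq
      (f := fun k => u k * w n - u n * w k + q ^ k * a * u (n - k)) ?_ ?_ ?_ m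
    · simp only [hw0, hu0, zpow_zero, sub_zero]
      ring
    · simp only [hw1, hu1, zpow_one]
      linear_combination hbase
    · intro k
      have h := hu (n - (k - 2))
      rw [show n - (k - 2) - 1 = n - (k - 1) by ring,
        show n - (k - 2) - 2 = n - k by ring] at h
      have e1 : q ^ (k - 1) = q ^ (k - 2) * q := by
        rw [← zpow_add_one₀ hq]; congr 1; ring
      have e2 : q ^ k = q ^ (k - 2) * q * q := by
        rw [← e1, ← zpow_add_one₀ hq]; congr 1; ring
      simp only [e1, e2]
      linear_combination w n * hu k - u n * hw k + q ^ (k - 2) * q * a * h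
  linear_combination hmain
end

section
/- For all integers t, s and n: u(t)·w(n) = u(s)·w(n+t−s) − q^t·u(s−t)·w(n−s). -/
/-- A two-sided second-order linear recurrence with vanishing initial values is zero. -/
theorem eq_zero_of_int_recurrence {p q : ℂ} (hq : q ≠ 0) {f : ℤ → ℂ}
    (hf : ∀ n : ℤ, f n = p * f (n - 1) - q * f (n - 2))
    (h0 : f 0 = 0) (h1 : f 1 = 0) (n : ℤ) : f n = 0 := by
  suffices h : f n = 0 ∧ f (n + 1) = 0 from h.1
  induction n using Int.induction_on with
  | zero => exact ⟨h0, by simpa using h1⟩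
  | succ k ih =>
    refine ⟨ih.2, ?_⟩
    have h := hf (k + 1 + 1)
    rw [show (k + 1 + 1 - 1 : ℤ) = k + 1 by ring, show (k + 1 + 1 - 2 : ℤ) = k by ring,
      ih.1, ih.2] at h
    simpa using h
  | pred k ih =>
    have h := hf (-k + 1)
    rw [show (-k + 1 - 1 : ℤ) = -k by ring, show (-k + 1 - 2 : ℤ) = -k - 1 by ring,
      ih.1, ih.2] at h
    refine ⟨?_, by simpa using ih.1⟩
    simpa [hq] using h

/-- The addition formula expressing a Horadam sequence through the Lucas sequence. -/
theorem horadam_add {p q : ℂ} (hq : q ≠ 0) {w u : ℤ → ℂ}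
    (hw : ∀ n : ℤ, w n = p * w (n - 1) - q * w (n - 2))
    (hu0 : u 0 = 0) (hu1 : u 1 = 1)
    (hu : ∀ n : ℤ, u n = p * u (n - 1) - q * u (n - 2)) (m s : ℤ) :
    w (m + s) = u s * w (m + 1) - q * u (s - 1) * w m := by
  rw [← sub_eq_zero]
  refine eq_zero_of_int_recurrence (p := p) hq
    (f := fun s => w (m + s) - (u s * w (m + 1) - q * u (s - 1) * w m)) ?_ ?_ ?_ s
  · intro s
    have h1 := hw (m + s)
    have h2 := hu s
    have h3 := hu (s - 1)
    rw [show s - 1 - 2 = s - 2 - 1 by ring] at h3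
    rw [add_sub_assoc, add_sub_assoc] at h1
    linear_combination h1 - w (m + 1) * h2 + q * w m * h3
  · have h := hu 1
    norm_num [hu0, hu1] at h
    norm_num [hu0]
    linear_combination w m * h
  · simp [hu0, hu1]

theorem stmt_11 (p q a b : ℂ) (hq : q ≠ 0) (w u : ℤ → ℂ)
    (hw0 : w 0 = a) (hw1 : w 1 = b)
    (hw : ∀ n : ℤ, w n = p * w (n - 1) - q * w (n - 2))
    (hu0 : u 0 = 0) (hu1 : u 1 = 1)
    (hu : ∀ n : ℤ, u n = p * u (n - 1) - q * u (n - 2))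
    (t s n : ℤ) :
    u t * w n = u s * w (n + t - s) - q ^ t * u (s - t) * w (n - s) := by
  rw [← sub_eq_zero]
  refine eq_zero_of_int_recurrence (p := p) hq
    (f := fun t => u t * w n - (u s * w (n + t - s) - q ^ t * u (s - t) * w (n - s)))
    ?_ ?_ ?_ t
  · intro t
    have h1 := hu t
    have h2 := hw (n + t - s)
    have h3 := hu (s - (t - 2))
    rw [show n + t - s - 1 = n + (t - 1) - s by ring,
      show n + t - s - 2 = n + (t - 2) - s by ring] at h2
    rw [show s - (t - 2) - 1 = s - (t - 1) by ring, show s - (t - 2) - 2 = s - t by ring] at h3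
    have e1 : q ^ (t - 1) = q ^ (t - 2) * q := by
      rw [← zpow_add_one₀ hq]; congr 1; ring
    have e2 : q ^ t = q ^ (t - 2) * q * q := by
      rw [← zpow_add_one₀ hq, ← zpow_add_one₀ hq]; congr 1; ring
    simp only [e1, e2]
    linear_combination w n * h1 - u s * h2 + q ^ (t - 2) * q * w (n - s) * h3
  · simp [hu0]
  · have h := horadam_add hq hw hu0 hu1 hu (n - s) s
    rw [sub_add_cancel, show n - s + 1 = n + 1 - s by ring] at h
    simp only [hu1, zpow_one]
    linear_combination h
end
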